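/- (Application of Trace Synchronization) Fix a binary relation R on State, a recursion variable X, a valuation V, and chop formulas Ψ, Ψ' ∈ CF_{(R,X)}. If L(gr(Ψ')) ⊆ L(gr(Ψ)), then ⟦μX.Ψ'⟧_V ⊆ ⟦μX.Ψ⟧_V. -/

import Mathlib

/-- A trace is a nonempty finite list of states (an element of `State⁺`). -/
abbrev Trace (State : Type) : Type := {l : List State // l ≠ []}

/-- Trace formulas: `Φ ::= p | R | Φ∧Φ | Φ∨Φ | Φ⌢Φ | X | μX.Φ`. -/
inductive TF (State RVar : Type) : Type where
  | pred : (State → Prop) → TF State RVar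
  | rel  : (State → State → Prop) → TF State RVar
  | conj : TF State RVar → TF State RVar → TF State RVar
  | disj : TF State RVar → TF State RVar → TF State RVar
  | chop : TF State RVar → TF State RVar → TF State RVar
  | var  : RVar → TF State RVar
  | mu   : RVar → TF State RVar → TF State RVar

/-- Chop of trace sets: `A ⋈ B = {σ·s·σ' | σ·s ∈ A ∧ s·σ' ∈ B}`,
the two parts overlapping in the single shared state `s`. -/
def chopSet {State : Type} (A B : Set (Trace State)) : Set (Trace State) :=
  {t | ∃ (σ σ' : List State) (s : State),
    t.1 = σ ++ s :: σ' ∧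
    (⟨σ ++ [s], by simp⟩ : Trace State) ∈ A ∧
    (⟨s :: σ', by simp⟩ : Trace State) ∈ B}

/-- Semantics of trace formulas under a valuation `V : RVar → 𝒫(State⁺)`. -/
def sem {State RVar : Type} [DecidableEq RVar] :
    TF State RVar → (RVar → Set (Trace State)) → Set (Trace State)
  | TF.pred p, _ => {t | ∃ (s : State) (σ : List State), t.1 = s :: σ ∧ p s}
  | TF.rel R, _ => {t | ∃ s s', t.1 = [s, s'] ∧ R s s'}
  | TF.conj a b, V => sem a V ∩ sem b V
  | TF.disj a b, V => sem a V ∪ sem b V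
  | TF.chop a b, V => chopSet (sem a V) (sem b V)
  | TF.var X, V => V X
  | TF.mu X a, V => ⋂₀ {γ : Set (Trace State) | sem a (Function.update V X γ) ⊆ γ}

/-- Atoms of primitive chop formulas over a fixed relation `R`
and recursion variable `X`: either `R` or `X`. A primitive chop formula
`S₁⌢…⌢S_k` is a (nonempty) list of atoms; since `grammatize` sends it to
the word `S₁S₂⋯S_k` over terminal `R` and nonterminal `X`, words of the
grammar are lists of atoms as well. -/
inductive Atom : Type where
  | r : Atom
  | x : Atom
deriving DecidableEq

/-- The trace formula denoted by an atom. -/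
def Atom.toTF {State RVar : Type} (R : State → State → Prop) (X : RVar) :
    Atom → TF State RVar
  | Atom.r => TF.rel R
  | Atom.x => TF.var X

/-- The trace formula `S₁⌢…⌢S_k` denoted by a primitive chop formula
(the empty list is mapped to a junk formula with empty semantics). -/
def pcfToTF {State RVar : Type} (R : State → State → Prop) (X : RVar) :
    List Atom → TF State RVar
  | [] => TF.pred fun _ => False
  | [a] => a.toTF R X
  | a :: b :: rest => TF.chop (a.toTF R X) (pcfToTF R X (b :: rest))

/-- The trace formula `⋁_{1≤j≤n} φ_j` denoted by a chop formula, i.e. by a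
finite disjunction of primitive chop formulas. -/
def cfToTF {State RVar : Type} (R : State → State → Prop) (X : RVar) :
    List (List Atom) → TF State RVar
  | [] => TF.pred fun _ => False
  | [c] => pcfToTF R X c
  | c :: d :: rest => TF.disj (pcfToTF R X c) (cfToTF R X (d :: rest))

/-- `SubstX S φ ψ`: `ψ` is obtained from `φ` by replacing each occurrence of
the atom `X` by some (possibly different) element of `S`. -/
inductive SubstX (S : Set (List Atom)) : List Atom → List Atom → Prop where
  | nil : SubstX S [] []
  | r {φ ψ : List Atom} : SubstX S φ ψ → SubstX S (Atom.r :: φ) (Atom.r :: ψ)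
  | x {φ ψ : List Atom} (c : List Atom) :
      c ∈ S → SubstX S φ ψ → SubstX S (Atom.x :: φ) (c ++ ψ)

/-- Derivability of sentential forms in the grammar `gr(Ψ)` with single
nonterminal `X`, single terminal `R`, initial nonterminal `X`, and one
production `X → S₁⋯S_k` for each disjunct `S₁⌢…⌢S_k` of `Ψ`. -/
inductive Derives (Ψ : List (List Atom)) : List Atom → Prop where
  | start : Derives Ψ [Atom.x]
  | step {u v c : List Atom} :
      c ∈ Ψ → Derives Ψ (u ++ Atom.x :: v) → Derives Ψ (u ++ c ++ v)

/-- `L(gr(Ψ)) ⊆ {R}*`: the terminal words derivable from `X` in `gr(Ψ)`. -/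
def Lang (Ψ : List (List Atom)) : Set (List Atom) :=
  {w | Derives Ψ w ∧ Atom.x ∉ w}

/-- Singleton traces, the unit of the chop. -/
def oneSet (State : Type) : Set (Trace State) := {t | ∃ s, t.1 = [s]}

/-- Semantics of an atom. -/
def atomSem {State : Type} (R : State → State → Prop) (γ : Set (Trace State)) :
    Atom → Set (Trace State)
  | Atom.r => {t | ∃ s s', t.1 = [s, s'] ∧ R s s'}
  | Atom.x => γ

/-- Semantics of a word. -/
def wordSem {State : Type} (R : State → State → Prop) (γ : Set (Trace State)) :
    List Atom → Set (Trace State)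
  | [] => oneSet State
  | a :: w => chopSet (atomSem R γ a) (wordSem R γ w)

theorem chopSet_mono {State : Type} {A A' B B' : Set (Trace State)} (hA : A ⊆ A') (hB : B ⊆ B') :
    chopSet A B ⊆ chopSet A' B' := by
  rintro t ⟨σ, σ', s, h, ha, hb⟩
  exact ⟨σ, σ', s, h, hA ha, hB hb⟩

theorem chopSet_one {State : Type} (A : Set (Trace State)) : chopSet A (oneSet State) = A := by
  ext ⟨t, ht⟩
  constructor
  · rintro ⟨σ, σ', s, h, ha, ⟨s', hb⟩⟩
    simp at hb h
    obtain ⟨rfl, rfl⟩ := hb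
    subst h
    exact ha
  · intro h
    obtain ⟨σ, s, rfl⟩ : ∃ σ s, t = σ ++ [s] := ⟨t.dropLast, t.getLast ht, (List.dropLast_append_getLast ht).symm⟩
    exact ⟨σ, [], s, rfl, h, s, rfl⟩

theorem one_chopSet {State : Type} (A : Set (Trace State)) : chopSet (oneSet State) A = A := by
  ext ⟨t, ht⟩
  constructor
  · rintro ⟨σ, σ', s, h, ⟨s', hb⟩, ha⟩
    have : σ = [] := by
      cases σ <;> simp at hb ⊢
    subst this
    simp at h
    subst h
    exact ha
  · intro h
    obtain ⟨s, σ, rfl⟩ := List.exists_cons_of_ne_nil ht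
    exact ⟨[], σ, s, rfl, ⟨s, rfl⟩, h⟩

theorem chopSet_assoc {State : Type} (A B C : Set (Trace State)) :
    chopSet (chopSet A B) C = chopSet A (chopSet B C) := by
  ext ⟨t, ht⟩
  constructor
  · rintro ⟨σ, σ', s, h, ⟨τ, τ', u, h2, ha, hb⟩, hc⟩
    simp only at h h2
    subst h
    rcases List.eq_nil_or_concat τ' with rfl | ⟨ρ, v, rfl⟩
    · obtain ⟨rfl, h3⟩ := List.append_inj' h2 rfl
      simp at h3
      subst h3
      exact ⟨σ, σ', s, rfl, ha, [], σ', s, rfl, hb, hc⟩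
    · have h3 : σ ++ [s] = (τ ++ u :: ρ) ++ [v] := by simpa using h2
      obtain ⟨rfl, h3⟩ := List.append_inj' h3 rfl
      simp at h3
      subst h3
      refine ⟨τ, ρ ++ s :: σ', u, by simp, ha, u :: ρ, σ', s, by simp, ?_, hc⟩
      simpa using hb
  · rintro ⟨σ, σ', s, h, ha, ⟨τ, τ', u, h2, hb, hc⟩⟩
    simp only at h h2
    subst h
    cases τ with
    | nil =>
      simp at h2
      obtain ⟨rfl, rfl⟩ := h2
      exact ⟨σ, σ', s, rfl, ⟨σ, [], s, rfl, ha, hb⟩, hc⟩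
    | cons v ρ =>
      simp at h2
      obtain ⟨rfl, rfl⟩ := h2
      refine ⟨σ ++ s :: ρ, τ', u, by simp, ⟨σ, ρ ++ [u], s, by simp, ha, ?_⟩, hc⟩
      simpa using hb

theorem wordSem_append {State : Type} (R : State → State → Prop) (γ : Set (Trace State))
    (u v : List Atom) :
    wordSem R γ (u ++ v) = chopSet (wordSem R γ u) (wordSem R γ v) := by
  induction u with
  | nil => simp [wordSem, one_chopSet]
  | cons a u ih => simp [wordSem, ih, chopSet_assoc]

theorem wordSem_terminal {State : Type} (R : State → State → Prop) (γ γ' : Set (Trace State))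
    (w : List Atom) (hw : Atom.x ∉ w) : wordSem R γ w = wordSem R γ' w := by
  induction w with
  | nil => rfl
  | cons a w ih =>
    simp at hw
    cases a with
    | r => simp [wordSem, ih hw.2, atomSem]
    | x => exact absurd rfl hw.1

theorem atom_sem {State RVar : Type} [DecidableEq RVar] (R : State → State → Prop) (X : RVar)
    (V : RVar → Set (Trace State)) (γ : Set (Trace State)) (a : Atom) :
    sem (a.toTF R X) (Function.update V X γ) = atomSem R γ a := by
  cases a <;> simp [Atom.toTF, sem, atomSem]

theorem pcf_sem {State RVar : Type} [DecidableEq RVar] (R : State → State → Prop) (X : RVar)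
    (V : RVar → Set (Trace State)) (γ : Set (Trace State)) (c : List Atom) (hc : c ≠ []) :
    sem (pcfToTF R X c) (Function.update V X γ) = wordSem R γ c := by
  induction c with
  | nil => exact absurd rfl hc
  | cons a c ih =>
    cases c with
    | nil => simp [pcfToTF, wordSem, chopSet_one, atom_sem]
    | cons b c =>
      rw [pcfToTF, sem, ih (by simp), atom_sem]
      rfl

theorem cf_sem {State RVar : Type} [DecidableEq RVar] (R : State → State → Prop) (X : RVar)
    (V : RVar → Set (Trace State)) (γ : Set (Trace State)) (Ψ : List (List Atom))
    (hp : ∀ c ∈ Ψ, c ≠ []) (t : Trace State) :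
    t ∈ sem (cfToTF R X Ψ) (Function.update V X γ) ↔ ∃ c ∈ Ψ, t ∈ wordSem R γ c := by
  induction Ψ with
  | nil => simp [cfToTF, sem]
  | cons a c ih =>
    have ha := pcf_sem R X V γ a (hp a (by simp))
    have ih := ih fun c hc => hp c (List.mem_cons_of_mem _ hc)
    cases c with
    | nil => simp [cfToTF, ha]
    | cons b c =>
      rw [cfToTF, sem, ha, Set.mem_union, ih]
      simp

theorem derives_subst {Ψ : List (List Atom)} {w : List Atom} (hw : Derives Ψ w)
    (u v : List Atom) (h : Derives Ψ (u ++ Atom.x :: v)) : Derives Ψ (u ++ w ++ v) := by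
  induction hw with
  | start => simpa using h
  | @step u' v' c hc _ ih =>
    have := Derives.step (u := u ++ u') (v := v' ++ v) hc (by simpa using ih)
    simpa using this

theorem derives_sem {State : Type} (R : State → State → Prop) (γ : Set (Trace State))
    {Ψ : List (List Atom)} (hγ : ∀ c ∈ Ψ, wordSem R γ c ⊆ γ) {w : List Atom}
    (hw : Derives Ψ w) : wordSem R γ w ⊆ γ := by
  induction hw with
  | start => simp [wordSem, atomSem, chopSet_one]
  | @step u v c hc _ ih =>
    refine subset_trans ?_ ih
    rw [List.append_assoc, wordSem_append, wordSem_append, wordSem_append]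
    exact chopSet_mono subset_rfl (chopSet_mono (hγ c hc) subset_rfl)

theorem unfold_sem {State : Type} (R : State → State → Prop) (Ψ : List (List Atom))
    (c : List Atom) : ∀ (u : List Atom), Derives Ψ (u ++ c) → ∀ t : Trace State,
      t ∈ wordSem R {t | ∃ w ∈ Lang Ψ, t ∈ wordSem R ∅ w} c →
      ∃ w, Atom.x ∉ w ∧ Derives Ψ (u ++ w) ∧ t ∈ wordSem R ∅ w := by
  induction c with
  | nil => exact fun u hu t ht => ⟨[], by simp, hu, ht⟩
  | cons a c ih =>
    rintro u hu t ⟨σ, σ', s, h, ha, hb⟩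
    cases a with
    | r =>
      obtain ⟨w, hx, hd, hw⟩ := ih (u ++ [Atom.r]) (by simpa using hu) _ hb
      exact ⟨Atom.r :: w, by simpa using hx, by simpa using hd, σ, σ', s, h, ha, hw⟩
    | x =>
      obtain ⟨w₁, ⟨hd₁, hx₁⟩, hw₁⟩ := ha
      obtain ⟨w, hx, hd, hw⟩ := ih (u ++ w₁) (derives_subst hd₁ u c hu) _ hb
      refine ⟨w₁ ++ w, by simp [hx, hx₁], by simpa using hd, ?_⟩
      rw [wordSem_append]
      exact ⟨σ, σ', s, h, hw₁, hw⟩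

/-- Application of Trace Synchronization: if
`L(gr(Ψ')) ⊆ L(gr(Ψ))` then `⟦μX.Ψ'⟧_V ⊆ ⟦μX.Ψ⟧_V`. -/
theorem trace_synchronization {State RVar : Type} [DecidableEq RVar]
    (R : State → State → Prop) (X : RVar) (V : RVar → Set (Trace State))
    (Ψ Ψ' : List (List Atom))
    (hΨ : Ψ ≠ []) (hpcf : ∀ c ∈ Ψ, c ≠ [])
    (hΨ' : Ψ' ≠ []) (hpcf' : ∀ c ∈ Ψ', c ≠ [])
    (h : Lang Ψ' ⊆ Lang Ψ) :
    sem (TF.mu X (cfToTF R X Ψ')) V ⊆ sem (TF.mu X (cfToTF R X Ψ)) V := by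
  intro t ht γ hγ
  have h1 : t ∈ {t : Trace State | ∃ w ∈ Lang Ψ', t ∈ wordSem R ∅ w} := by
    refine ht _ ?_
    intro t ht
    obtain ⟨c, hc, ht⟩ := (cf_sem R X V _ Ψ' hpcf' t).1 ht
    have hd : Derives Ψ' ([] ++ c) := by
      simpa using Derives.step (u := []) (v := []) hc Derives.start
    obtain ⟨w, hx, hd, hw⟩ := unfold_sem R Ψ' c [] hd t ht
    exact ⟨w, ⟨hd, hx⟩, hw⟩
  obtain ⟨w, hw, ht⟩ := h1
  obtain ⟨hd, hx⟩ := h hw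
  rw [wordSem_terminal R ∅ γ w hx] at ht
  refine derives_sem R γ (fun c hc t ht => hγ ?_) hd ht
  exact (cf_sem R X V γ Ψ hpcf t).2 ⟨c, hc, ht⟩
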